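/- arXiv:1312.2968 — 2 statements merged into one kernel-verified Lean document; each statement's English description precedes it below -/
import Mathlib

section
/- Let X₁,…,Xₙ be i.i.d. with distribution function F, and let x ≤ y be reals with p_x − p_y ≥ 1/n. Then for all u ≥ 0, P( |p̂_x − p̂_y − (p_x − p_y)| ≥ u ) ≤ 2·exp( −√n·u/√(p_x − p_y) ) + 2·exp( −n·u²/(2(p_x − p_y)) ). -/
open MeasureTheory Filter Set Asymptotics

noncomputable section

/-- The CDF of a measure on `ℝ`. -/
def cdfR (μ : Measure ℝ) (x : ℝ) : ℝ := (μ (Iic x)).toReal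

/-- The second order Pareto class `S(τ, β, C, C')`: càdlàg distribution functions on `[0,∞)`
(here encoded via their laws, probability measures giving no mass to `(-∞,0)`) such that
`|1 - F(x) - C·x^(-τ)| ≤ C'·x^(-τ(β+1))` whenever `F(x) ∈ (0,1]`. -/
def SOP (τ β C C' : ℝ) : Set (Measure ℝ) :=
  {μ | IsProbabilityMeasure μ ∧ μ (Iio 0) = 0 ∧
    ∀ x : ℝ, cdfR μ x ∈ Ioc (0 : ℝ) 1 →
      |1 - cdfR μ x - C * x ^ (-τ)| ≤ C' * x ^ (-(τ * (β + 1)))}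

/-- Joint law of `n` i.i.d. observations with common law `μ`. -/
def iidP (μ : Measure ℝ) (n : ℕ) : Measure (Fin n → ℝ) := Measure.pi fun _ => μ

/-- The empirical tail probability `p̂_x = n⁻¹ Σ_i 1{X_i > x}`. -/
def empTail (n : ℕ) (ω : Fin n → ℝ) (x : ℝ) : ℝ :=
  ((Finset.univ.filter fun i => x < ω i).card : ℝ) / n

/-- The empirical increment is the average of the indicators of `(x, y]`. -/
lemma empTail_sub_empTail (n : ℕ) (ω : Fin n → ℝ) {x y : ℝ} (hxy : x ≤ y) :
    empTail n ω x - empTail n ω y = (∑ i, (Ioc x y).indicator (1 : ℝ → ℝ) (ω i)) / n := by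
  unfold empTail
  rw [← sub_div, Finset.card_filter, Finset.card_filter]
  push_cast
  rw [← Finset.sum_sub_distrib]
  congr 1
  refine Finset.sum_congr rfl fun i _ => ?_
  by_cases h1 : x < ω i <;> by_cases h2 : y < ω i
  · simp [h1, h2]
  · simp [h1, h2, not_lt.mp h2]
  · exact absurd (hxy.trans_lt h2) h1
  · simp [h1, h2]

lemma measureReal_Ioc_eq (μ : Measure ℝ) [IsProbabilityMeasure μ] {x y : ℝ} (hxy : x ≤ y) :
    μ.real (Ioc x y) = (1 - cdfR μ x) - (1 - cdfR μ y) := by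
  have h := measureReal_sdiff (μ := μ) (Iic_subset_Iic.2 hxy) measurableSet_Iic
  rw [show Iic y \ Iic x = Ioc x y by ext; simp [and_comm]] at h
  rw [h]
  simp only [cdfR, Measure.real]
  ring

lemma integral_exp_mul_indicator (μ : Measure ℝ) [IsProbabilityMeasure μ] {s : Set ℝ}
    (hs : MeasurableSet s) (l : ℝ) :
    ∫ t, Real.exp (l * s.indicator (1 : ℝ → ℝ) t) ∂μ = 1 + μ.real s * (Real.exp l - 1) := by
  have h : (fun t => Real.exp (l * s.indicator (1 : ℝ → ℝ) t)) =
      fun t => 1 + s.indicator (fun _ => Real.exp l - 1) t := by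
    funext t
    by_cases ht : t ∈ s <;> simp [ht]
  rw [h, integral_add (integrable_const _) ((integrable_const _).indicator hs),
    integral_indicator_const _ hs]
  simp

/-- Chernoff bound for the number of observations falling in `s`, in either direction. -/
lemma iidP_sum_indicator_le_exp (μ : Measure ℝ) [IsProbabilityMeasure μ] (n : ℕ) {s : Set ℝ}
    (hs : MeasurableSet s) (l a : ℝ) :
    (iidP μ n).real {ω | a ≤ l * ∑ i, s.indicator (1 : ℝ → ℝ) (ω i)} ≤
      Real.exp (n * μ.real s * (Real.exp l - 1) - a) := by
  have hprob : IsProbabilityMeasure (iidP μ n) := by unfold iidP; infer_instance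
  have hprod : (fun ω : Fin n → ℝ => Real.exp (1 * (l * ∑ i, s.indicator (1 : ℝ → ℝ) (ω i)))) =
      fun ω => ∏ i, Real.exp (l * s.indicator (1 : ℝ → ℝ) (ω i)) := by
    funext ω
    rw [one_mul, Finset.mul_sum, Real.exp_sum]
  have hint1 : Integrable (fun t => Real.exp (l * s.indicator (1 : ℝ → ℝ) t)) μ := by
    refine Integrable.of_bound (C := Real.exp |l|) ?_ (ae_of_all _ fun t => ?_)
    · have : Measurable (s.indicator (1 : ℝ → ℝ)) := measurable_one.indicator hs
      exact (this.const_mul l).exp.aestronglyMeasurable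
    · rw [Real.norm_eq_abs, Real.abs_exp, Real.exp_le_exp]
      by_cases ht : t ∈ s
      · simp [ht, le_abs_self]
      · simp [ht]
  have hint : Integrable
      (fun ω : Fin n → ℝ => Real.exp (1 * (l * ∑ i, s.indicator (1 : ℝ → ℝ) (ω i))))
      (iidP μ n) := by
    rw [hprod]
    exact Integrable.fintype_prod fun _ => hint1
  have h := ProbabilityTheory.measure_ge_le_exp_mul_mgf a zero_le_one hint
  refine h.trans ?_
  have hmgf : ProbabilityTheory.mgf (fun ω : Fin n → ℝ => l * ∑ i, s.indicator (1 : ℝ → ℝ) (ω i))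
      (iidP μ n) 1 = (1 + μ.real s * (Real.exp l - 1)) ^ n := by
    unfold ProbabilityTheory.mgf
    rw [hprod, iidP, integral_fintype_prod_eq_pow (ι := Fin n)
      (f := fun t => Real.exp (l * s.indicator (1 : ℝ → ℝ) t)), integral_exp_mul_indicator μ hs,
      Fintype.card_fin]
  have hnonneg : 0 ≤ 1 + μ.real s * (Real.exp l - 1) := by
    rw [← integral_exp_mul_indicator μ hs]
    exact integral_nonneg fun t => (Real.exp_pos _).le
  have hle : (1 + μ.real s * (Real.exp l - 1)) ^ n ≤
      Real.exp (n * μ.real s * (Real.exp l - 1)) := by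
    rw [mul_assoc, Real.exp_nat_mul]
    refine pow_le_pow_left₀ hnonneg ?_ n
    linarith [Real.add_one_le_exp (μ.real s * (Real.exp l - 1))]
  rw [hmgf, sub_eq_neg_add _ a, Real.exp_add, neg_one_mul]
  gcongr

lemma exp_sub_one_sub_le_of_le_one {x : ℝ} (h0 : 0 ≤ x) (h1 : x ≤ 1) :
    Real.exp x - 1 - x ≤ 3 / 4 * x ^ 2 := by
  have h := Real.exp_bound' h0 h1 (n := 3) (by norm_num)
  norm_num [Finset.sum_range_succ, Nat.factorial] at h
  nlinarith [mul_nonneg (sq_nonneg x) (sub_nonneg.2 h1)]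

lemma exp_sub_one_sub_le_of_le_three_halves {x : ℝ} (h0 : 0 ≤ x) (h1 : x ≤ 3 / 2) :
    Real.exp x - 1 - x ≤ 24 / 25 * x ^ 2 := by
  obtain ⟨y, rfl⟩ : ∃ y, x = 2 * y := ⟨x / 2, by ring⟩
  have hy0 : 0 ≤ y := by linarith
  have hy1 : y ≤ 3 / 4 := by linarith
  have h := Real.exp_bound' hy0 (by linarith) (n := 3) (by norm_num)
  norm_num [Finset.sum_range_succ, Nat.factorial] at h
  have hy2 : y ^ 2 ≤ 9 / 16 := by nlinarith
  have hb : Real.exp y ≤ 1 + y + 2 / 3 * y ^ 2 := by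
    nlinarith [mul_nonneg (sq_nonneg y) (sub_nonneg.2 hy1)]
  have he : Real.exp (2 * y) ≤ (1 + y + 2 / 3 * y ^ 2) ^ 2 := by
    rw [two_mul, Real.exp_add, sq]
    exact mul_le_mul hb hb (Real.exp_pos _).le (by positivity)
  nlinarith [mul_nonneg (sq_nonneg y) (sub_nonneg.2 hy1),
    mul_nonneg (sq_nonneg y) (sub_nonneg.2 hy2)]

lemma exp_neg_le_quadratic {x : ℝ} (hx : 0 ≤ x) : Real.exp (-x) ≤ 1 - x + x ^ 2 / 2 := by
  have h := Real.quadratic_le_exp_of_nonneg hx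
  have hpos : 0 < 1 + x + x ^ 2 / 2 := by positivity
  rw [Real.exp_neg]
  refine (inv_anti₀ hpos h).trans ?_
  rw [inv_le_iff_one_le_mul₀ hpos]
  nlinarith [sq_nonneg (x ^ 2)]

/-- Lower tail of the centred count, on the scale of its standard deviation. -/
lemma iidP_lower_tail (μ : Measure ℝ) [IsProbabilityMeasure μ] (n : ℕ) {A : Set ℝ}
    (hA : MeasurableSet A) {r s : ℝ} (hr : 0 < r) (hr2 : r ^ 2 = n * μ.real A) (hs : 0 ≤ s) :
    (iidP μ n).real {ω | ∑ i, A.indicator (1 : ℝ → ℝ) (ω i) ≤ r ^ 2 - s * r} ≤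
      Real.exp (-(s ^ 2 / 2)) := by
  have hprob : IsProbabilityMeasure (iidP μ n) := by unfold iidP; infer_instance
  refine (measureReal_mono fun ω hω => ?_).trans
    ((iidP_sum_indicator_le_exp μ n hA (-(s / r)) (-(s / r) * (r ^ 2 - s * r))).trans ?_)
  · exact mul_le_mul_of_nonpos_left (by exact hω) (neg_nonpos.2 (div_nonneg hs hr.le))
  · rw [← hr2, Real.exp_le_exp]
    have h := mul_le_mul_of_nonneg_left (exp_neg_le_quadratic (x := s / r) (by positivity))
      (sq_nonneg r)
    have e1 : r ^ 2 * (1 - s / r + (s / r) ^ 2 / 2) = r ^ 2 - s * r + s ^ 2 / 2 := by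
      field_simp
    have e2 : -(s / r) * (r ^ 2 - s * r) = -(s * r) + s ^ 2 := by
      field_simp
      ring
    rw [e1] at h
    rw [e2]
    linarith

/-- Upper tail of the centred count, given a quadratic bound on the exponential at `c / r`. -/
lemma iidP_upper_tail (μ : Measure ℝ) [IsProbabilityMeasure μ] (n : ℕ) {A : Set ℝ}
    (hA : MeasurableSet A) {r s c K : ℝ} (hr : 0 < r) (hr2 : r ^ 2 = n * μ.real A) (hc : 0 ≤ c)
    (hK : Real.exp (c / r) - 1 - c / r ≤ K * (c / r) ^ 2) :
    (iidP μ n).real {ω | r ^ 2 + s * r ≤ ∑ i, A.indicator (1 : ℝ → ℝ) (ω i)} ≤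
      Real.exp (K * c ^ 2 - c * s) := by
  have hprob : IsProbabilityMeasure (iidP μ n) := by unfold iidP; infer_instance
  refine (measureReal_mono fun ω hω => ?_).trans
    ((iidP_sum_indicator_le_exp μ n hA (c / r) (c / r * (r ^ 2 + s * r))).trans ?_)
  · exact mul_le_mul_of_nonneg_left (by exact hω) (div_nonneg hc hr.le)
  · rw [← hr2, Real.exp_le_exp]
    have h := mul_le_mul_of_nonneg_left hK (sq_nonneg r)
    have e1 : r ^ 2 * (K * (c / r) ^ 2) = K * c ^ 2 := by
      field_simp
    have e2 : c / r * (r ^ 2 + s * r) = r ^ 2 * (c / r) + c * s := by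
      field_simp
    rw [e1] at h
    rw [e2]
    linarith

lemma exp_three_lt : Real.exp 3 < 20.2 := by
  have h : Real.exp 3 = Real.exp 1 ^ 3 := by rw [← Real.exp_nat_mul]; norm_num
  rw [h]
  calc Real.exp 1 ^ 3 < 2.7183 ^ 3 :=
        pow_lt_pow_left₀ (by linarith [Real.exp_one_lt_d9]) (Real.exp_pos _).le (by norm_num)
    _ < 20.2 := by norm_num

lemma iidP_upper_tail_le (μ : Measure ℝ) [IsProbabilityMeasure μ] (n : ℕ) {A : Set ℝ}
    (hA : MeasurableSet A) {r s : ℝ} (hr : 1 ≤ r) (hr2 : r ^ 2 = n * μ.real A) (hs : 0 ≤ s) :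
    (iidP μ n).real {ω | r ^ 2 + s * r ≤ ∑ i, A.indicator (1 : ℝ → ℝ) (ω i)} ≤
      2 * Real.exp (-s) + Real.exp (-(s ^ 2 / 2)) := by
  have hr0 : 0 < r := by linarith
  rcases le_total s 3 with h3 | h3
  · refine (iidP_upper_tail μ n hA hr0 hr2 zero_le_one (exp_sub_one_sub_le_of_le_one
      (by positivity) ((div_le_one hr0).2 hr))).trans ?_
    have h34 : Real.exp (3 / 4) ≤ 2.2 := by
      refine le_of_pow_le_pow_left₀ (n := 4) (by norm_num) (by norm_num) ?_
      rw [← Real.exp_nat_mul]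
      norm_num
      linarith [exp_three_lt]
    have h32 : Real.exp (3 / 2) ≤ 5 := by
      refine le_of_pow_le_pow_left₀ (n := 2) (by norm_num) (by norm_num) ?_
      rw [← Real.exp_nat_mul]
      norm_num
      linarith [exp_three_lt]
    have hinv : 1 / 5 ≤ Real.exp (-(3 / 2)) := by
      rw [Real.exp_neg, one_div]
      exact inv_anti₀ (Real.exp_pos _) h32
    have hsq : Real.exp (-(3 / 2)) * Real.exp (-s) ≤ Real.exp (-(s ^ 2 / 2)) := by
      rw [← Real.exp_add, Real.exp_le_exp]
      nlinarith
    have e : Real.exp (3 / 4 * 1 ^ 2 - 1 * s) = Real.exp (3 / 4) * Real.exp (-s) := by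
      rw [← Real.exp_add]
      ring_nf
    rw [e]
    nlinarith [Real.exp_pos (-s)]
  · refine (iidP_upper_tail μ n hA hr0 hr2 (c := 3 / 2) (by norm_num)
      (exp_sub_one_sub_le_of_le_three_halves (by positivity)
        (div_le_self (by norm_num) hr))).trans ?_
    have h : Real.exp (24 / 25 * (3 / 2) ^ 2 - 3 / 2 * s) ≤ 2 * Real.exp (-s) := by
      rw [← Real.exp_log (show (0 : ℝ) < 2 by norm_num), ← Real.exp_add, Real.exp_le_exp,
        Real.exp_log (by norm_num)]
      linarith [Real.log_two_gt_d9]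
    linarith [Real.exp_pos (-(s ^ 2 / 2))]

/-- Bernstein-type bound: for `x ≤ y` with `p_x - p_y ≥ 1/n` and `u ≥ 0`,
`P(|p̂_x - p̂_y - (p_x - p_y)| ≥ u) ≤ 2exp(-√n·u/√(p_x-p_y)) + 2exp(-nu²/(2(p_x-p_y)))`. -/
theorem increment_tail_bound
    (μ : Measure ℝ) (hμ : IsProbabilityMeasure μ) (n : ℕ) (x y : ℝ) (hxy : x ≤ y)
    (hp : 1 / (n : ℝ) ≤ (1 - cdfR μ x) - (1 - cdfR μ y)) (u : ℝ) (hu : 0 ≤ u) :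
    (iidP μ n {ω |
        u ≤ |empTail n ω x - empTail n ω y - ((1 - cdfR μ x) - (1 - cdfR μ y))|}).toReal ≤
      2 * Real.exp (-(Real.sqrt n * u / Real.sqrt ((1 - cdfR μ x) - (1 - cdfR μ y)))) +
        2 * Real.exp (-((n : ℝ) * u ^ 2 / (2 * ((1 - cdfR μ x) - (1 - cdfR μ y))))) := by
  have hP : IsProbabilityMeasure (iidP μ n) := by unfold iidP; infer_instance
  rw [← measureReal_Ioc_eq μ hxy] at hp ⊢
  set p := μ.real (Ioc x y) with hpdef
  change (iidP μ n).real _ ≤ _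
  rcases Nat.eq_zero_or_pos n with rfl | hn
  · refine measureReal_le_one.trans ?_
    norm_num
  have hn' : (0 : ℝ) < n := by exact_mod_cast hn
  have hp0 : 0 < p := lt_of_lt_of_le (by positivity) hp
  have hnp : 1 ≤ n * p := by rwa [div_le_iff₀' hn'] at hp
  set r := √(n * p) with hrdef
  have hr2 : r ^ 2 = n * p := Real.sq_sqrt (by linarith)
  have hr : 1 ≤ r := Real.one_le_sqrt.2 hnp
  have hr0 : 0 < r := by linarith
  set s := √n * u / √p with hsdef
  have hs : 0 ≤ s := by positivity
  have hs2 : n * u ^ 2 / (2 * p) = s ^ 2 / 2 := by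
    rw [hsdef, div_pow, mul_pow, Real.sq_sqrt hn'.le, Real.sq_sqrt hp0.le]
    field_simp
  have hsr : s * r = n * u := by
    rw [hsdef, hrdef, Real.sqrt_mul hn'.le]
    have := Real.sqrt_pos.2 hp0
    field_simp
    rw [Real.sq_sqrt hn'.le, mul_comm]
  rw [hs2]
  have hsub : {ω | u ≤ |empTail n ω x - empTail n ω y - p|} ⊆
      {ω | r ^ 2 + s * r ≤ ∑ i, (Ioc x y).indicator (1 : ℝ → ℝ) (ω i)} ∪
      {ω | ∑ i, (Ioc x y).indicator (1 : ℝ → ℝ) (ω i) ≤ r ^ 2 - s * r} := by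
    intro ω hω
    rw [mem_ofPred_eq, empTail_sub_empTail n ω hxy, le_abs] at hω
    rw [mem_union, mem_ofPred_eq, mem_ofPred_eq, hsr, hr2]
    refine hω.imp (fun h => ?_) fun h => ?_
    · have h' := (le_div_iff₀ hn').1 (le_sub_iff_add_le.1 h)
      linarith
    · have h' := (div_le_iff₀ hn').1 (le_sub_comm.1 (h.trans_eq (neg_sub _ p)))
      linarith
  refine (measureReal_mono hsub).trans ((measureReal_union_le _ _).trans ?_)
  linarith [iidP_upper_tail_le μ n measurableSet_Ioc hr hr2 hs,
    iidP_lower_tail μ n measurableSet_Ioc hr0 hr2 hs]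

end
end

section
/- Let τ, β₁ > 0, υ > 0, and C' > 0 with C'² ≤ (2β₁+1)/(3τ²(β₁+1)²). Set B = n^{1/(τ(2β₁+1))} and t = υ·B^{−τβ₁} = υ·n^{−β₁/(2β₁+1)}, and assume n is large enough that t ≤ min( √3·υτ/(2√(2β₁+1)), τ/4 ). Let C̃ > 0 satisfy (1+C̃)^t = 1 + C'·(1+C̃)^{−τβ₁}·t/υ and set B₁ = (1+C̃)B. Define F₁ by 1−F₁(x) = x^{−τ} for 1 ≤ x ≤ B, 1−F₁(x) = B^{−t}·x^{−τ+t} for B < x < B₁, and 1−F₁(x) = x^{−τ} + C'·x^{−τ(1+β₁)} for x ≥ B₁. Then F₁ is a continuous distribution function, F₁ ∈ S(τ,β₁,1,C'), and C̃ ≤ e^{C'/υ} − 1 (so B₁ ≤ e^{C'/υ}·B). -/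
open MeasureTheory Filter Set Asymptotics

noncomputable section

/-- The perturbed Pareto distribution function of the lower-bound construction. -/
def F1 (τ β₁ C' t B B₁ : ℝ) (x : ℝ) : ℝ :=
  if x < 1 then 0
  else if x ≤ B then 1 - x ^ (-τ)
  else if x < B₁ then 1 - B ^ (-t) * x ^ (-τ + t)
  else 1 - (x ^ (-τ) + C' * x ^ (-(τ * (1 + β₁))))

/-- The survival function of `F1`, written as a lattice combination of its three branches. -/
def paretoTail (τ β₁ C' t B y : ℝ) : ℝ :=
  min (max (y ^ (-τ)) (B ^ (-t) * y ^ (-τ + t))) (y ^ (-τ) + C' * y ^ (-(τ * (1 + β₁))))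

lemma middle_branch_eq {τ t B y : ℝ} (hB : 0 < B) (hy : 0 < y) :
    B ^ (-t) * y ^ (-τ + t) = y ^ (-τ) * (y / B) ^ t := by
  rw [Real.rpow_add hy, Real.div_rpow hy.le hB.le, Real.rpow_neg hB.le]
  ring

lemma last_branch_eq {τ β₁ C' y : ℝ} (hy : 0 < y) :
    y ^ (-τ) + C' * y ^ (-(τ * (1 + β₁))) = y ^ (-τ) * (1 + C' * y ^ (-(τ * β₁))) := by
  rw [show -(τ * (1 + β₁)) = -τ + -(τ * β₁) by ring, Real.rpow_add hy]
  ring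

lemma F1_eq_one_sub_paretoTail {τ β₁ C' t B B₁ : ℝ} (hτ : 0 < τ) (hβ₁ : 0 < β₁) (hC' : 0 < C')
    (ht : 0 < t) (hB : 1 ≤ B) (hBB₁ : B < B₁)
    (hglue : (B₁ / B) ^ t = 1 + C' * B₁ ^ (-(τ * β₁))) (x : ℝ) :
    F1 τ β₁ C' t B B₁ x = 1 - paretoTail τ β₁ C' t B (max x 1) := by
  have hB0 : 0 < B := by linarith
  have hτβ : 0 ≤ τ * β₁ := by positivity
  have first : ∀ y, 0 < y → y ≤ B → paretoTail τ β₁ C' t B y = y ^ (-τ) := by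
    intro y hy hyB
    have h₁ : (y / B) ^ t ≤ 1 :=
      Real.rpow_le_one (by positivity) ((div_le_one hB0).2 hyB) ht.le
    unfold paretoTail
    rw [middle_branch_eq hB0 hy, max_eq_left, min_eq_left]
    · have : 0 ≤ C' * y ^ (-(τ * (1 + β₁))) := by positivity
      linarith
    · exact mul_le_of_le_one_right (by positivity) h₁
  have middle_ge : ∀ y, B ≤ y → 1 ≤ (y / B) ^ t := fun y hy =>
    Real.one_le_rpow ((one_le_div hB0).2 hy) ht.le
  by_cases hx1 : x < 1
  · rw [max_eq_right hx1.le, first 1 one_pos hB]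
    simp [F1, hx1]
  have hx1' : 1 ≤ x := not_lt.1 hx1
  have hx : 0 < x := by linarith
  rw [max_eq_left hx1']
  by_cases hxB : x ≤ B
  · rw [first x hx hxB]
    simp [F1, hx1, hxB]
  have hxB' : B ≤ x := (not_le.1 hxB).le
  have hmax : max (x ^ (-τ)) (x ^ (-τ) * (x / B) ^ t) = x ^ (-τ) * (x / B) ^ t :=
    max_eq_right (le_mul_of_one_le_right (by positivity) (middle_ge x hxB'))
  unfold F1 paretoTail
  rw [if_neg hx1, if_neg hxB, middle_branch_eq hB0 hx, last_branch_eq hx, hmax]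
  split_ifs with hxB₁
  · rw [min_eq_left]
    refine mul_le_mul_of_nonneg_left ?_ (by positivity)
    calc (x / B) ^ t ≤ (B₁ / B) ^ t := by gcongr
      _ = 1 + C' * B₁ ^ (-(τ * β₁)) := hglue
      _ ≤ 1 + C' * x ^ (-(τ * β₁)) := by
        have := Real.rpow_le_rpow_of_nonpos hx hxB₁.le (neg_nonpos.2 hτβ)
        gcongr
  · have hxB₁' : B₁ ≤ x := not_lt.1 hxB₁
    rw [min_eq_right]
    refine mul_le_mul_of_nonneg_left ?_ (by positivity)
    calc 1 + C' * x ^ (-(τ * β₁)) ≤ 1 + C' * B₁ ^ (-(τ * β₁)) := by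
          have := Real.rpow_le_rpow_of_nonpos (hB0.trans hBB₁) hxB₁' (neg_nonpos.2 hτβ)
          gcongr
      _ = (B₁ / B) ^ t := hglue.symm
      _ ≤ (x / B) ^ t := by
        have : 0 < B₁ := hB0.trans hBB₁
        gcongr

lemma continuous_paretoTail_max_one (τ β₁ C' t B : ℝ) :
    Continuous fun x => paretoTail τ β₁ C' t B (max x 1) := by
  have h : ∀ p : ℝ, Continuous fun x : ℝ => (max x 1) ^ p := fun p =>
    (continuous_id.max continuous_const).rpow_const fun x =>
      Or.inl (lt_of_lt_of_le one_pos (le_max_right x 1)).ne'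
  exact ((h _).max (continuous_const.mul (h _))).min ((h _).add (continuous_const.mul (h _)))

lemma antitone_paretoTail_max_one {τ β₁ C' t B : ℝ} (hτ : 0 ≤ τ) (hβ₁ : 0 ≤ β₁) (hC' : 0 ≤ C')
    (htτ : t ≤ τ) (hB : 0 ≤ B) :
    Antitone fun x => paretoTail τ β₁ C' t B (max x 1) := by
  intro x y hxy
  have h : ∀ p : ℝ, p ≤ 0 → (max y 1) ^ p ≤ (max x 1) ^ p := fun p hp =>
    Real.rpow_le_rpow_of_nonpos (lt_of_lt_of_le one_pos (le_max_right x 1))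
      (max_le_max_right 1 hxy) hp
  have h₁ := h (-τ) (by linarith)
  have h₂ := h (-τ + t) (by linarith)
  have h₃ := h (-(τ * (1 + β₁))) (neg_nonpos.2 (by positivity))
  unfold paretoTail
  refine min_le_min (max_le_max h₁ ?_) (add_le_add h₁ ?_)
  · exact mul_le_mul_of_nonneg_left h₂ (by positivity)
  · exact mul_le_mul_of_nonneg_left h₃ hC'

lemma rpow_neg_le_paretoTail {τ β₁ C' t B y : ℝ} (hC' : 0 ≤ C') (hy : 0 ≤ y) :
    y ^ (-τ) ≤ paretoTail τ β₁ C' t B y :=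
  le_min (le_max_left _ _) (le_add_of_nonneg_right (by positivity))

lemma tendsto_paretoTail_max_one {τ β₁ C' t B : ℝ} (hτ : 0 < τ) (hβ₁ : 0 < β₁) (hC' : 0 ≤ C') :
    Tendsto (fun x => paretoTail τ β₁ C' t B (max x 1)) atTop (nhds 0) := by
  have hmax : Tendsto (fun x : ℝ => max x 1) atTop atTop :=
    tendsto_atTop_mono (fun x => le_max_left x 1) tendsto_id
  have h₁ := (tendsto_rpow_neg_atTop hτ).comp hmax
  have h₂ := (tendsto_rpow_neg_atTop (show 0 < τ * (1 + β₁) by positivity)).comp hmax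
  refine squeeze_zero (fun x => ?_) (fun x => min_le_right _ _)
    (by simpa using h₁.add (h₂.const_mul C'))
  have hx : 0 ≤ max x 1 := zero_le_one.trans (le_max_right x 1)
  exact (Real.rpow_nonneg hx _).trans (rpow_neg_le_paretoTail hC' hx)

/-- A continuous monotone function vanishing on `(-∞, 0]` with limit `1` at `+∞` is the
distribution function of a probability measure on `[0, ∞)`. -/
lemma exists_measure_cdfR_eq {F : ℝ → ℝ} (hc : Continuous F) (hm : Monotone F)
    (h₀ : ∀ x ≤ 0, F x = 0) (h₁ : Tendsto F atTop (nhds 1)) :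
    ∃ μ : Measure ℝ, IsProbabilityMeasure μ ∧ (∀ x, cdfR μ x = F x) ∧ μ (Iio 0) = 0 := by
  let S : StieltjesFunction ℝ := ⟨F, hm, fun x => hc.continuousWithinAt⟩
  have hbot : Tendsto S atBot (nhds 0) :=
    tendsto_const_nhds.congr' ((eventually_le_atBot 0).mono fun x hx => (h₀ x hx).symm)
  have hIic : ∀ x, S.measure (Iic x) = ENNReal.ofReal (F x) := fun x => by
    rw [S.measure_Iic hbot, sub_zero]
  refine ⟨S.measure, S.isProbabilityMeasure hbot h₁, fun x => ?_, ?_⟩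
  · have hx : 0 ≤ F x := by
      rw [← h₀ (min x 0) (min_le_right x 0)]
      exact hm (min_le_left x 0)
    rw [cdfR, hIic, ENNReal.toReal_ofReal hx]
  · refine measure_mono_null Iio_subset_Iic_self ?_
    rw [hIic, h₀ 0 le_rfl, ENNReal.ofReal_zero]

/-- Lower-bound construction: `F₁` is a continuous distribution function belonging to
`S(τ,β₁,1,C')`, and `C̃ ≤ e^{C'/υ} - 1`, so that `B₁ ≤ e^{C'/υ}·B`. -/
theorem perturbed_pareto_construction
    (τ β₁ υ C' : ℝ) (n : ℕ) (B t B₁ Ct : ℝ)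
    (hτ : 0 < τ) (hβ₁ : 0 < β₁) (hυ : 0 < υ) (hC' : 0 < C') (hn : 1 ≤ n)
    (hC'2 : C' ^ 2 ≤ (2 * β₁ + 1) / (3 * τ ^ 2 * (β₁ + 1) ^ 2))
    (hB : B = (n : ℝ) ^ (1 / (τ * (2 * β₁ + 1))))
    (ht : t = υ * B ^ (-(τ * β₁)))
    (htsmall : t ≤ min (Real.sqrt 3 * υ * τ / (2 * Real.sqrt (2 * β₁ + 1))) (τ / 4))
    (hCt : 0 < Ct)
    (hCteq : (1 + Ct) ^ t = 1 + C' * (1 + Ct) ^ (-(τ * β₁)) * t / υ)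
    (hB₁ : B₁ = (1 + Ct) * B) :
    Continuous (F1 τ β₁ C' t B B₁) ∧
    (∃ μ₁ : Measure ℝ, IsProbabilityMeasure μ₁ ∧
      (∀ x : ℝ, cdfR μ₁ x = F1 τ β₁ C' t B B₁ x) ∧ μ₁ ∈ SOP τ β₁ 1 C') ∧
    Ct ≤ Real.exp (C' / υ) - 1 ∧ B₁ ≤ Real.exp (C' / υ) * B := by
  have hn' : (1 : ℝ) ≤ n := by exact_mod_cast hn
  have hB1 : 1 ≤ B := by
    rw [hB]
    exact Real.one_le_rpow hn' (by positivity)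
  have hB0 : 0 < B := by linarith
  have ht0 : 0 < t := by rw [ht]; positivity
  have htτ : t ≤ τ := by linarith [htsmall.trans (min_le_right _ _)]
  have hBB₁ : B < B₁ := by rw [hB₁]; nlinarith
  have hglue : (B₁ / B) ^ t = 1 + C' * B₁ ^ (-(τ * β₁)) := by
    have hdiv : t / υ = B ^ (-(τ * β₁)) := by rw [ht]; field_simp
    rw [hB₁, mul_div_cancel_right₀ _ hB0.ne', hCteq, Real.mul_rpow (by positivity) hB0.le, ← hdiv]
    ring
  have hF := F1_eq_one_sub_paretoTail hτ hβ₁ hC' ht0 hB1 hBB₁ hglue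
  have hFfun : F1 τ β₁ C' t B B₁ = fun x => 1 - paretoTail τ β₁ C' t B (max x 1) := funext hF
  have hcont : Continuous (F1 τ β₁ C' t B B₁) := by
    rw [hFfun]
    exact continuous_const.sub (continuous_paretoTail_max_one τ β₁ C' t B)
  have hmono : Monotone (F1 τ β₁ C' t B B₁) := by
    rw [hFfun]
    exact fun x y hxy => sub_le_sub_left
      (antitone_paretoTail_max_one hτ.le hβ₁.le hC'.le htτ hB0.le hxy) 1
  have htop : Tendsto (F1 τ β₁ C' t B B₁) atTop (nhds 1) := by
    rw [hFfun]
    simpa using (tendsto_paretoTail_max_one hτ hβ₁ hC'.le).const_sub 1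
  have hzero : ∀ x < 1, F1 τ β₁ C' t B B₁ x = 0 := fun x hx => if_pos hx
  have hCt_le : 1 + Ct ≤ Real.exp (C' / υ) := by
    have hpow : (1 + Ct) ^ (-(τ * β₁)) ≤ 1 :=
      Real.rpow_le_one_of_one_le_of_nonpos (by linarith) (neg_nonpos.2 (by positivity))
    refine (Real.rpow_le_rpow_iff (by positivity) (by positivity) ht0).1 ?_
    calc (1 + Ct) ^ t = 1 + C' * (1 + Ct) ^ (-(τ * β₁)) * t / υ := hCteq
      _ ≤ 1 + C' * 1 * t / υ := by gcongr
      _ = C' / υ * t + 1 := by ring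
      _ ≤ Real.exp (C' / υ * t) := Real.add_one_le_exp _
      _ = Real.exp (C' / υ) ^ t := Real.exp_mul _ _
  obtain ⟨μ, hμ, hcdf, hneg⟩ :=
    exists_measure_cdfR_eq hcont hmono (fun x hx => hzero x (by linarith)) htop
  refine ⟨hcont, ⟨μ, hμ, hcdf, hμ, hneg, fun x hx => ?_⟩, by linarith, ?_⟩
  · rw [hcdf] at hx ⊢
    have hx1 : 1 ≤ x := by
      by_contra! h
      exact hx.1.ne' (hzero x h)
    have hlow : x ^ (-τ) ≤ paretoTail τ β₁ C' t B x :=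
      rpow_neg_le_paretoTail hC'.le (by linarith)
    have hupp : paretoTail τ β₁ C' t B x ≤ x ^ (-τ) + C' * x ^ (-(τ * (1 + β₁))) :=
      min_le_right _ _
    rw [hF, max_eq_left hx1, add_comm β₁ 1, abs_of_nonneg (by linarith)]
    linarith
  · rw [hB₁]
    exact mul_le_mul_of_nonneg_right hCt_le hB0.le

end
end
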